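/- For all real square matrices X, Y of size n×n, the Frobenius norm of the commutator satisfies ‖XY − YX‖_F ≤ √2 · ‖X‖_F · ‖Y‖_F. -/

import Mathlib

/-- The Frobenius norm of a real square matrix. -/
noncomputable def frobNorm {n : ℕ} (A : Matrix (Fin n) (Fin n) ℝ) : ℝ :=
  Real.sqrt (∑ i, ∑ j, (A i j) ^ 2)

namespace Matrix

variable {ι : Type*} [Fintype ι]

theorem trace_transpose_mul_self_eq_sum (A : Matrix ι ι ℝ) :
    (Aᵀ * A).trace = ∑ i, ∑ j, (A i j) ^ 2 := by
  simp only [trace, diag_apply, mul_apply, transpose_apply, ← sq]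
  exact Finset.sum_comm

theorem trace_transpose_mul_self_nonneg (A : Matrix ι ι ℝ) : 0 ≤ (Aᵀ * A).trace := by
  rw [trace_transpose_mul_self_eq_sum]
  positivity

/-- `‖XZ - ZX‖² ≤ tr (X (ZZᵀ + ZᵀZ) Xᵀ) + tr (Xᵀ (ZZᵀ + ZᵀZ) X)` in the Frobenius norm. -/
theorem trace_commutator_le (X Z : Matrix ι ι ℝ) :
    ((X * Z - Z * X)ᵀ * (X * Z - Z * X)).trace ≤
      (X * (Z * Zᵀ + Zᵀ * Z) * Xᵀ).trace + (Xᵀ * (Z * Zᵀ + Zᵀ * Z) * X).trace := by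
  have h := trace_transpose_mul_self_nonneg (Xᵀ * Z + Z * Xᵀ)
  have h₁ := trace_mul_comm (Zᵀ * Xᵀ) (X * Z)
  have h₂ := trace_mul_comm (Zᵀ * X) (Xᵀ * Z)
  have h₃ := trace_mul_comm (Zᵀ * Xᵀ * Z) X
  have h₄ := trace_mul_comm (Zᵀ * X * Z) Xᵀ
  simp only [transpose_add, transpose_sub, transpose_mul, transpose_transpose, mul_add, add_mul,
    mul_sub, sub_mul, trace_add, trace_sub, Matrix.mul_assoc] at *
  linarith

/-- A skew-symmetric matrix has operator norm at most `‖K‖ / √2`. -/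
theorem posSemidef_of_skew [DecidableEq ι] {K : Matrix ι ι ℝ} (hK : Kᵀ = -K) :
    (((Kᵀ * K).trace / 2) • (1 : Matrix ι ι ℝ) - Kᵀ * K).PosSemidef := by
  refine .of_dotProduct_mulVec_nonneg ?_ fun v ↦ ?_
  · simp [IsHermitian, conjTranspose_eq_transpose_of_trivial]
  set w := K *ᵥ v with hw
  set s := v ⬝ᵥ v with hs
  have hww : v ⬝ᵥ ((Kᵀ * K) *ᵥ v) = w ⬝ᵥ w := by
    rw [← mulVec_mulVec, dotProduct_mulVec, vecMul_transpose]
  have hvK : v ᵥ* K = -w := by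
    rw [← mulVec_transpose, hK, neg_mulVec]
  have h := trace_transpose_mul_self_nonneg (s • K - (vecMulVec w v - vecMulVec v w))
  have key : ((s • K - (vecMulVec w v - vecMulVec v w))ᵀ *
      (s • K - (vecMulVec w v - vecMulVec v w))).trace =
      s ^ 2 * (Kᵀ * K).trace - 2 * s * (w ⬝ᵥ w) - 2 * (v ⬝ᵥ w) ^ 2 := by
    have hwK : w ᵥ* K ⬝ᵥ v = w ⬝ᵥ w := by rw [← dotProduct_mulVec]
    simp only [transpose_sub, transpose_smul, transpose_vecMulVec, sub_mul, mul_sub, trace_sub,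
      smul_mul, Matrix.mul_smul, trace_smul, smul_eq_mul, vecMulVec_mul, mul_vecMulVec, hvK,
      trace_vecMulVec, vecMulVec_mulVec, smul_mulVec, mulVec_transpose, smul_dotProduct,
      neg_dotProduct, dotProduct_neg, hwK]
    simp [dotProduct_comm w v, dotProduct_comm v (w ᵥ* K), hwK, ← hs]
    ring
  have hs0 : 0 ≤ s := by simpa using dotProduct_star_self_nonneg v
  simp only [star_trivial, sub_mulVec, dotProduct_sub, hww, smul_mulVec, one_mulVec,
    dotProduct_smul, smul_eq_mul, ← hs]
  rcases hs0.eq_or_lt with h0 | h0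
  · have : v = 0 := by simpa [hs] using h0.symm
    simp [hw, hs, this]
  · have : 0 ≤ s * ((Kᵀ * K).trace / 2 * s - w ⬝ᵥ w) := by
      nlinarith [sq_nonneg (v ⬝ᵥ w)]
    exact nonneg_of_mul_nonneg_right this h0

theorem exists_sq_sub_le_half_sum_sq (a : ι → ℝ) :
    ∃ c, ∀ i, (a i - c) ^ 2 ≤ (∑ j, a j ^ 2) / 2 := by
  classical
  rcases isEmpty_or_nonempty ι with _ | _
  · exact ⟨0, isEmptyElim⟩
  obtain ⟨p, hp⟩ := Finite.exists_max a
  obtain ⟨q, hq⟩ := Finite.exists_min a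
  refine ⟨(a p + a q) / 2, fun i ↦ ?_⟩
  have h₁ : (a i - (a p + a q) / 2) ^ 2 ≤ (a p - a q) ^ 2 / 4 := by
    nlinarith [mul_nonneg (sub_nonneg.2 (hp i)) (sub_nonneg.2 (hq i))]
  by_cases hpq : p = q
  · have : 0 ≤ ∑ j, a j ^ 2 := by positivity
    subst hpq
    nlinarith
  · have : a p ^ 2 + a q ^ 2 ≤ ∑ j, a j ^ 2 := by
      rw [← Finset.sum_pair (f := fun j ↦ a j ^ 2) hpq]
      exact Finset.sum_le_sum_of_subset_of_nonneg (Finset.subset_univ _)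
        fun _ _ _ ↦ sq_nonneg _
    nlinarith [sq_nonneg (a p + a q)]

/-- A symmetric matrix has a scalar shift of operator norm at most `‖S‖ / √2`. -/
theorem exists_posSemidef_of_symm [DecidableEq ι] {S : Matrix ι ι ℝ} (hS : Sᵀ = S) :
    ∃ c : ℝ, (((S * S).trace / 2) • (1 : Matrix ι ι ℝ) -
      (S - c • 1) * (S - c • 1)).PosSemidef := by
  have hH : S.IsHermitian := by
    rwa [IsHermitian, conjTranspose_eq_transpose_of_trivial]
  obtain ⟨c, hc⟩ := exists_sq_sub_le_half_sum_sq hH.eigenvalues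
  set φ := Unitary.conjStarAlgAut ℝ (Matrix ι ι ℝ) hH.eigenvectorUnitary with hφ
  have hSφ : S = φ (diagonal hH.eigenvalues) := hH.spectral_theorem
  have htr : (S * S).trace = ∑ i, hH.eigenvalues i ^ 2 := by
    conv_lhs => rw [hSφ, ← map_mul, hφ, Unitary.conjStarAlgAut_apply, trace_mul_comm,
      ← Matrix.mul_assoc, Unitary.coe_star_mul_self, Matrix.one_mul, diagonal_mul_diagonal,
      trace_diagonal]
    simp [sq]
  refine ⟨c, ?_⟩
  have hE : ((S * S).trace / 2) • (1 : Matrix ι ι ℝ) - (S - c • 1) * (S - c • 1) =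
      φ (diagonal fun i ↦ (∑ j, hH.eigenvalues j ^ 2) / 2 - (hH.eigenvalues i - c) ^ 2) := by
    have hd : (diagonal fun i ↦ (∑ j, hH.eigenvalues j ^ 2) / 2 - (hH.eigenvalues i - c) ^ 2) =
        ((S * S).trace / 2) • (1 : Matrix ι ι ℝ) -
          (diagonal hH.eigenvalues - c • 1) * (diagonal hH.eigenvalues - c • 1) := by
      simp only [htr, smul_one_eq_diagonal, diagonal_sub, diagonal_mul_diagonal, sq]
    rw [hd, map_sub, map_mul, map_sub, map_smul, map_smul, map_one, ← hSφ]
  rw [hE, hφ, Unitary.conjStarAlgAut_apply]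
  refine PosSemidef.mul_mul_conjTranspose_same ?_ _
  exact posSemidef_diagonal_iff.2 fun i ↦ sub_nonneg.2 (hc i)

theorem exists_posSemidef_shift [DecidableEq ι] (Y : Matrix ι ι ℝ) :
    ∃ c : ℝ, ((Yᵀ * Y).trace • (1 : Matrix ι ι ℝ) -
      ((Y - c • 1) * (Y - c • 1)ᵀ + (Y - c • 1)ᵀ * (Y - c • 1))).PosSemidef := by
  obtain ⟨S, K, hS, hK, rfl⟩ : ∃ S K : Matrix ι ι ℝ, Sᵀ = S ∧ Kᵀ = -K ∧ Y = S + K :=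
    ⟨(1 / 2 : ℝ) • (Y + Yᵀ), (1 / 2 : ℝ) • (Y - Yᵀ), by simp [add_comm], by
      simp [← smul_neg], by module⟩
  obtain ⟨c, hc⟩ := exists_posSemidef_of_symm hS
  have h := (hc.add (posSemidef_of_skew hK)).smul (zero_le_two (α := ℝ))
  refine ⟨c, ?_⟩
  have htr : ((S + K)ᵀ * (S + K)).trace = (S * S).trace + (Kᵀ * K).trace := by
    have := trace_mul_comm S K
    simp only [transpose_add, hS, hK, add_mul, mul_add, trace_add, neg_mul, trace_neg]
    linarith
  convert h using 1
  rw [htr]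
  simp only [transpose_add, transpose_sub, transpose_smul, transpose_one, hS, hK, mul_add, add_mul,
    sub_mul, mul_sub, smul_mul, Matrix.mul_smul, Matrix.mul_one, Matrix.one_mul, neg_mul, mul_neg]
  module

theorem trace_commutator_le_two_mul (X Y : Matrix ι ι ℝ) :
    ((X * Y - Y * X)ᵀ * (X * Y - Y * X)).trace ≤ 2 * (Xᵀ * X).trace * (Yᵀ * Y).trace := by
  classical
  obtain ⟨c, hc⟩ := exists_posSemidef_shift Y
  have hcomm : X * Y - Y * X = X * (Y - c • 1) - (Y - c • 1) * X := by
    simp [mul_sub, sub_mul]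
  have h₁ := (hc.mul_mul_conjTranspose_same X).trace_nonneg
  have h₂ := (hc.mul_mul_conjTranspose_same Xᵀ).trace_nonneg
  have h₃ := trace_commutator_le X (Y - c • 1)
  rw [← hcomm] at h₃
  have hX := trace_mul_comm X Xᵀ
  rw [conjTranspose_eq_transpose_of_trivial, mul_sub, sub_mul, trace_sub, Matrix.mul_smul, smul_mul,
    Matrix.mul_one, trace_smul, smul_eq_mul] at h₁ h₂
  rw [transpose_transpose] at h₂
  rw [hX] at h₁
  linarith

end Matrix

/-- The Böttcher–Wenzel inequality: `‖XY − YX‖_F ≤ √2 ‖X‖_F ‖Y‖_F`. -/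
theorem boettcher_wenzel {n : ℕ} (X Y : Matrix (Fin n) (Fin n) ℝ) :
    frobNorm (X * Y - Y * X) ≤ Real.sqrt 2 * frobNorm X * frobNorm Y := by
  have h := Matrix.trace_commutator_le_two_mul X Y
  have hX := Matrix.trace_transpose_mul_self_nonneg X
  simp only [frobNorm, ← Matrix.trace_transpose_mul_self_eq_sum]
  rw [← Real.sqrt_mul zero_le_two, ← Real.sqrt_mul (by positivity)]
  exact Real.sqrt_le_sqrt h
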